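/- Uniqueness of the quantum Painlevé II Hamiltonian (Takano characterization). Let F = ℂ(t) be the field of rational functions in t, let V = F(z) be the field of rational functions in z over F, and let R be the F-algebra of F-linear endomorphisms of V. Let h ∈ ℂ, h ≠ 0, and a, b ∈ ℂ with a + b + 2h = 1. Let q ∈ R be multiplication by z (which is invertible) and p = −h·(d/dz) ∈ R, so that qp − pq = h·1. Set x₀ = q⁻¹, y₀ = −bq − q²p, x₁ = q⁻¹, y₁ = 2q⁴ − q²p + tq² − aq, and let A₀ (resp. A₁) be the F-subalgebra of R generated by x₀, y₀ (resp. x₁, y₁). Suppose H = Σ_{0 ≤ i,j ≤ 4, (i,j) ≠ (0,0)} k_{ij} qⁱpʲ with coefficients k_{ij} ∈ F, and suppose that [x₀, H] ∈ A₀, [y₀, H] ∈ A₀, [x₁, H] ∈ A₁, and [y₁, H] + h·q² ∈ A₁ (the last condition expressing that (1/h)[y₁,H] + ∂y₁/∂t is polynomial in the chart-1 coordinates). Then H = (1/2)p² − q²p − (t/2)p − bq, i.e. H is the quantum Painlevé II Hamiltonian H_II. -/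

import Mathlib

set_option synthInstance.maxHeartbeats 1000000
set_option maxHeartbeats 4000000

namespace QuantumPII

open RatFunc

variable {K : Type*} [Field K]

section Gauge

variable (D : Derivation K (RatFunc K) (RatFunc K)) (h : K)

/-- The gauge-transformed momentum `-h·(d/dz) + φ`. -/
noncomputable def momentum (φ : RatFunc K) : Module.End K (RatFunc K) :=
  -(h • (D : RatFunc K →ₗ[K] RatFunc K)) + LinearMap.mulLeft K φ

lemma momentum_apply (φ v : RatFunc K) : momentum D h φ v = -(h • D v) + φ * v := by
  simp [momentum]

/-- The differential operator with left coefficients `f` in the momentum of gauge `φ`. -/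
noncomputable def diffOp (φ : RatFunc K) :
    (ℕ →₀ RatFunc K) →ₗ[RatFunc K] Module.End K (RatFunc K) :=
  Finsupp.linearCombination (RatFunc K) (fun j => momentum D h φ ^ j)

/-- `S'` arises from the differential operator `S` by replacing the momentum `-h·(d/dz)` with
`-h·(d/dz) + φ`. -/
def GaugeRel (φ : RatFunc K) (S S' : Module.End K (RatFunc K)) : Prop :=
  ∃ f, diffOp D h 0 f = S ∧ diffOp D h φ f = S'

variable {D h} {φ : RatFunc K}

lemma momentum_mul_smul (c : RatFunc K) (S : Module.End K (RatFunc K)) :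
    momentum D h φ * (c • S) = c • (momentum D h φ * S) + (-(h • D c)) • S := by
  ext v
  simp only [Module.End.mul_apply, LinearMap.add_apply, LinearMap.smul_apply, momentum_apply,
    smul_eq_mul, Derivation.leibniz, smul_add]
  simp only [Algebra.smul_def]
  ring

namespace GaugeRel

lemma smul {S S'} (c : RatFunc K) (hS : GaugeRel D h φ S S') : GaugeRel D h φ (c • S) (c • S') := by
  obtain ⟨f, rfl, rfl⟩ := hS
  exact ⟨c • f, by simp, by simp⟩

lemma add {S S' T T'} (hS : GaugeRel D h φ S S') (hT : GaugeRel D h φ T T') :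
    GaugeRel D h φ (S + T) (S' + T') := by
  obtain ⟨f, rfl, rfl⟩ := hS
  obtain ⟨g, rfl, rfl⟩ := hT
  exact ⟨f + g, by simp, by simp⟩

lemma zero : GaugeRel D h φ 0 0 := ⟨0, by simp, by simp⟩

lemma one : GaugeRel D h φ 1 1 := ⟨Finsupp.single 0 1, by simp [diffOp], by simp [diffOp]⟩

lemma mulLeft (c : RatFunc K) :
    GaugeRel D h φ (LinearMap.mulLeft K c) (LinearMap.mulLeft K c) := by
  have : LinearMap.mulLeft K c = c • (1 : Module.End K (RatFunc K)) := by ext; simp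
  rw [this]
  exact one.smul c

lemma smul_base {S S'} (c : K) (hS : GaugeRel D h φ S S') : GaugeRel D h φ (c • S) (c • S') := by
  simpa only [algebraMap_smul] using hS.smul (algebraMap K (RatFunc K) c)

lemma neg {S S'} (hS : GaugeRel D h φ S S') : GaugeRel D h φ (-S) (-S') := by
  simpa using hS.smul (-1)

lemma sub {S S' T T'} (hS : GaugeRel D h φ S S') (hT : GaugeRel D h φ T T') :
    GaugeRel D h φ (S - T) (S' - T') := by
  simpa [sub_eq_add_neg] using hS.add hT.neg

lemma sum {ι : Type*} (s : Finset ι) {S S' : ι → Module.End K (RatFunc K)}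
    (hS : ∀ i ∈ s, GaugeRel D h φ (S i) (S' i)) :
    GaugeRel D h φ (∑ i ∈ s, S i) (∑ i ∈ s, S' i) := by
  classical
  induction s using Finset.induction_on with
  | empty => simpa using zero
  | insert i s hi ih =>
    rw [Finset.sum_insert hi, Finset.sum_insert hi]
    exact (hS i (by simp)).add (ih fun j hj => hS j (by simp [hj]))

lemma momentum_mul {S S'} (hS : GaugeRel D h φ S S') :
    GaugeRel D h φ (momentum D h 0 * S) (momentum D h φ * S') := by
  obtain ⟨f, rfl, rfl⟩ := hS
  induction f using Finsupp.induction_linear with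
  | zero => simpa using zero
  | add f g hf hg => simpa [mul_add] using hf.add hg
  | single j c =>
    simp only [diffOp, Finsupp.linearCombination_single, momentum_mul_smul, ← pow_succ']
    refine ⟨Finsupp.single (j + 1) c + Finsupp.single j (-(h • D c)), ?_, ?_⟩ <;>
      simp [diffOp]

lemma momentum_pow_mul {S S'} (hS : GaugeRel D h φ S S') (j : ℕ) :
    GaugeRel D h φ (momentum D h 0 ^ j * S) (momentum D h φ ^ j * S') := by
  induction j with
  | zero => simpa using hS
  | succ j ih => simpa [pow_succ', mul_assoc] using ih.momentum_mul

lemma mul {S S' T T'} (hS : GaugeRel D h φ S S') (hT : GaugeRel D h φ T T') :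
    GaugeRel D h φ (S * T) (S' * T') := by
  obtain ⟨f, rfl, rfl⟩ := hS
  induction f using Finsupp.induction_linear with
  | zero => simpa using zero
  | add f g hf hg => simpa [add_mul] using hf.add hg
  | single j c =>
    simp only [diffOp, Finsupp.linearCombination_single, smul_mul_assoc]
    exact (hT.momentum_pow_mul j).smul c

lemma pow {S S'} (hS : GaugeRel D h φ S S') (n : ℕ) : GaugeRel D h φ (S ^ n) (S' ^ n) := by
  induction n with
  | zero => simpa using one
  | succ n ih => simpa [pow_succ] using ih.mul hS

lemma momentum : GaugeRel D h φ (momentum D h 0) (momentum D h φ) := by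
  simpa using one.momentum_mul

end GaugeRel

lemma momentum_zero_pow_apply_X_pow (hD : D X = 1) (j n : ℕ) :
    (momentum D h 0 ^ j) (X ^ n) =
      algebraMap K (RatFunc K) ((-h) ^ j * n.descFactorial j) * X ^ (n - j) := by
  induction j with
  | zero => simp
  | succ j ih =>
    rw [pow_succ', Module.End.mul_apply, ih, momentum_apply, ← Algebra.smul_def, Derivation.map_smul,
      Derivation.leibniz_pow, hD, Nat.descFactorial_succ, Nat.sub_sub]
    simp only [smul_eq_mul]
    simp only [Algebra.smul_def, map_mul, map_pow, map_neg, map_natCast, nsmul_eq_mul, zero_mul,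
      Nat.cast_mul]
    ring

variable [CharZero K]

lemma diffOp_zero_injective (hh : h ≠ 0) (hD : D X = 1) :
    Function.Injective (diffOp D h 0) := by
  rw [injective_iff_map_eq_zero]
  intro f hf
  ext n
  induction n using Nat.strong_induction_on with
  | _ n ih =>
    have key := congrArg (fun S : Module.End K (RatFunc K) => S (X ^ n)) hf
    simp only [diffOp, Finsupp.linearCombination_apply, Finsupp.sum, LinearMap.sum_apply,
      LinearMap.smul_apply, LinearMap.zero_apply, momentum_zero_pow_apply_X_pow hD,
      smul_eq_mul] at key
    rw [Finset.sum_eq_single n] at key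
    · have : algebraMap K (RatFunc K) ((-h) ^ n * n.descFactorial n) ≠ 0 := by
        rw [map_ne_zero]
        simp [hh, Nat.descFactorial_self, Nat.factorial_ne_zero]
      simpa [this, hh, Nat.factorial_ne_zero, Nat.descFactorial_self] using key
    · intro j _ hj
      rcases lt_or_gt_of_ne hj with hlt | hgt
      · simp [ih j hlt]
      · simp [Nat.descFactorial_eq_zero_iff_lt.mpr hgt]
    · intro hn
      simp [Finsupp.notMem_support_iff.mp hn]

lemma GaugeRel.unique (hh : h ≠ 0) (hD : D X = 1) {S S' T'} (h₁ : GaugeRel D h φ S S')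
    (h₂ : GaugeRel D h φ S T') : S' = T' := by
  obtain ⟨f, hf, rfl⟩ := h₁
  obtain ⟨g, hg, rfl⟩ := h₂
  rw [diffOp_zero_injective hh hD (hf.trans hg.symm)]

/-- An operator in the algebra generated by `x, y` stabilizes, after a change of gauge, any subspace
that the gauge transforms of `x` and `y` stabilize. -/
lemma GaugeRel.mapsTo_of_mem_adjoin (hh : h ≠ 0) (hD : D X = 1)
    {x y x' y' T T' : Module.End K (RatFunc K)} (hx : GaugeRel D h φ x x')
    (hy : GaugeRel D h φ y y') (hT : GaugeRel D h φ T T')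
    (L : Submodule K (RatFunc K)) (hxL : ∀ v ∈ L, x' v ∈ L) (hyL : ∀ v ∈ L, y' v ∈ L)
    (hmem : T ∈ Algebra.adjoin K {x, y}) : ∀ v ∈ L, T' v ∈ L := by
  suffices ∃ S', GaugeRel D h φ T S' ∧ ∀ v ∈ L, S' v ∈ L by
    obtain ⟨S', hS', hL⟩ := this
    rwa [hT.unique hh hD hS']
  clear hT
  induction hmem using Algebra.adjoin_induction with
  | mem S hS =>
    rcases hS with rfl | rfl
    exacts [⟨x', hx, hxL⟩, ⟨y', hy, hyL⟩]
  | algebraMap r =>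
    refine ⟨algebraMap K _ r, ?_, fun v hv => ?_⟩
    · simpa only [Algebra.algebraMap_eq_smul_one] using one.smul_base r
    · simpa using L.smul_mem r hv
  | add S T _ _ hS hT =>
    obtain ⟨S', hS, hSL⟩ := hS
    obtain ⟨T', hT, hTL⟩ := hT
    exact ⟨S' + T', hS.add hT, fun v hv => L.add_mem (hSL v hv) (hTL v hv)⟩
  | mul S T _ _ hS hT =>
    obtain ⟨S', hS, hSL⟩ := hS
    obtain ⟨T', hT, hTL⟩ := hT
    exact ⟨S' * T', hS.mul hT, fun v hv => hSL _ (hTL v hv)⟩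

end Gauge

section Laurent

/-- The `n`-th coefficient of the Laurent expansion at `0`. -/
noncomputable def laurentCoeff (n : ℤ) : RatFunc K →ₗ[K] K where
  toFun v := (algebraMap (RatFunc K) (LaurentSeries K) v).coeff n
  map_add' u v := by simp
  map_smul' c v := by
    have : algebraMap (RatFunc K) (LaurentSeries K) (algebraMap K (RatFunc K) c)
        = HahnSeries.C c := by
      rw [IsScalarTower.algebraMap_apply K (Polynomial K) (RatFunc K),
        ← IsScalarTower.algebraMap_apply (Polynomial K) (RatFunc K) (LaurentSeries K)]
      simp
    rw [Algebra.smul_def, map_mul, this]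
    simp

lemma laurentCoeff_X_zpow_mul (n m : ℤ) (v : RatFunc K) :
    laurentCoeff n (X ^ m * v) = laurentCoeff (n - m) v := by
  simp [laurentCoeff, ← RatFunc.single_zpow, HahnSeries.coeff_single_mul]

lemma laurentCoeff_X_zpow (n m : ℤ) :
    laurentCoeff n (X ^ m : RatFunc K) = if n = m then 1 else 0 := by
  simp [laurentCoeff, ← RatFunc.single_zpow, HahnSeries.coeff_single]

variable (K) in
/-- The Laurent polynomials in `z`. -/
noncomputable def laurentSpan : Submodule K (RatFunc K) :=
  Submodule.span K (Set.range fun n : ℤ => (X : RatFunc K) ^ n)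

lemma X_zpow_mem (n : ℤ) : (X : RatFunc K) ^ n ∈ laurentSpan K :=
  Submodule.subset_span ⟨n, rfl⟩

lemma X_zpow_mul_mem (n : ℤ) {v : RatFunc K} (hv : v ∈ laurentSpan K) :
    X ^ n * v ∈ laurentSpan K := by
  induction hv using Submodule.span_induction with
  | mem v hv =>
    obtain ⟨m, rfl⟩ := hv
    simpa only [← zpow_add₀ (RatFunc.X_ne_zero (K := K))] using X_zpow_mem (n + m)
  | zero => simp
  | add u v _ _ hu hv => simpa [mul_add] using add_mem hu hv
  | smul c v _ hv => simpa using Submodule.smul_mem _ c hv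

variable {D : Derivation K (RatFunc K) (RatFunc K)}

lemma derivation_X_zpow (hD : D X = 1) (n : ℤ) : D (X ^ n) = (n : K) • X ^ (n - 1) := by
  rw [Derivation.leibniz_zpow, hD]
  simp [Algebra.smul_def]

lemma derivation_mem (hD : D X = 1) {v : RatFunc K} (hv : v ∈ laurentSpan K) :
    D v ∈ laurentSpan K := by
  induction hv using Submodule.span_induction with
  | mem v hv =>
    obtain ⟨m, rfl⟩ := hv
    simpa only [derivation_X_zpow hD] using Submodule.smul_mem _ _ (X_zpow_mem _)
  | zero => simp
  | add u v _ _ hu hv => simpa using add_mem hu hv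
  | smul c v _ hv => simpa using Submodule.smul_mem _ c hv

lemma laurentCoeff_derivation (hD : D X = 1) (n : ℤ) {v : RatFunc K} (hv : v ∈ laurentSpan K) :
    laurentCoeff n (D v) = (n + 1) * laurentCoeff (n + 1) v := by
  induction hv using Submodule.span_induction with
  | mem v hv =>
    obtain ⟨m, rfl⟩ := hv
    simp only [derivation_X_zpow hD, map_smul, laurentCoeff_X_zpow, smul_eq_mul]
    by_cases hm : n + 1 = m
    · subst hm; simp
    · rw [if_neg hm, if_neg (by lia)]; simp
  | zero => simp
  | add u v _ _ hu hv => simp [hu, hv, mul_add]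
  | smul c v _ hv => simp [hv]; ring

variable (K) in
/-- The polynomials in `1/z`. -/
noncomputable def regularAtInfinity : Submodule K (RatFunc K) :=
  laurentSpan K ⊓ ⨅ n : Set.Ioi (0 : ℤ), LinearMap.ker (laurentCoeff (K := K) n)

lemma mem_regularAtInfinity {v : RatFunc K} :
    v ∈ regularAtInfinity K ↔ v ∈ laurentSpan K ∧ ∀ n : ℤ, 0 < n → laurentCoeff n v = 0 := by
  simp [regularAtInfinity]

lemma inv_X_mul_mem_regularAtInfinity {v : RatFunc K} (hv : v ∈ regularAtInfinity K) :
    X⁻¹ * v ∈ regularAtInfinity K := by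
  rw [mem_regularAtInfinity] at hv ⊢
  rw [← zpow_neg_one]
  refine ⟨X_zpow_mul_mem _ hv.1, fun n hn => ?_⟩
  rw [laurentCoeff_X_zpow_mul]
  exact hv.2 _ (by lia)

lemma laurentCoeff_X_sq_mul_derivation (hD : D X = 1) (n : ℤ) {v : RatFunc K}
    (hv : v ∈ laurentSpan K) :
    laurentCoeff n (X ^ 2 * D v) = (n - 1) * laurentCoeff (n - 1) v := by
  rw [← zpow_natCast, laurentCoeff_X_zpow_mul, laurentCoeff_derivation hD _ hv]
  push_cast
  rw [show n - 2 + 1 = n - 1 by ring]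
  ring

lemma X_sq_mul_derivation_mem_regularAtInfinity_iff [CharZero K] (hD : D X = 1) {v : RatFunc K}
    (hv : v ∈ laurentSpan K) :
    X ^ 2 * D v ∈ regularAtInfinity K ↔ v ∈ regularAtInfinity K := by
  have hmem : X ^ 2 * D v ∈ laurentSpan K := by
    simpa using X_zpow_mul_mem 2 (derivation_mem hD hv)
  simp only [mem_regularAtInfinity, hmem, hv, true_and, laurentCoeff_X_sq_mul_derivation hD _ hv]
  constructor
  · intro H n hn
    have := H (n + 1) (by lia)
    have hn' : (n : K) ≠ 0 := by exact_mod_cast hn.ne'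
    simpa [hn'] using this
  · intro H n hn
    rcases eq_or_ne n 1 with rfl | h1
    · simp
    · simp [H (n - 1) (by lia)]

end Laurent

section Expansion

/-- The coefficient of `z ^ s` in `(-h·(d/dz) - α/z + τ + β z²) ^ j` applied to `z ^ (-m)`. -/
def gaugeCoeff (h α β τ : K) (m : ℕ) : ℕ → ℤ → K
  | 0, s => if s = -m then 1 else 0
  | j + 1, s => -(h * (s + 1) + α) * gaugeCoeff h α β τ m j (s + 1)
      + τ * gaugeCoeff h α β τ m j s + β * gaugeCoeff h α β τ m j (s - 2)

/-- The gauge function `-α/z + τ + β z²`. -/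
noncomputable def gaugeFun (α β τ : K) : RatFunc K :=
  -(α • X⁻¹) + algebraMap K (RatFunc K) τ + β • X ^ 2

variable {D : Derivation K (RatFunc K) (RatFunc K)} {h α β τ : K}

lemma momentum_gaugeFun_apply (v : RatFunc K) :
    momentum D h (gaugeFun α β τ) v =
      -(h • D v) - α • (X ^ (-1 : ℤ) * v) + τ • v + β • (X ^ (2 : ℤ) * v) := by
  rw [momentum_apply, gaugeFun]
  simp only [Algebra.smul_def, zpow_neg_one, zpow_ofNat]
  ring

lemma momentum_pow_apply_mem (hD : D X = 1) (m j : ℕ) :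
    (momentum D h (gaugeFun α β τ) ^ j) (X ^ (-m : ℤ)) ∈ laurentSpan K := by
  induction j with
  | zero => exact X_zpow_mem (-m : ℤ)
  | succ j ih =>
    rw [pow_succ', Module.End.mul_apply, momentum_gaugeFun_apply]
    have hs : ∀ (c : K) {v}, v ∈ laurentSpan K → c • v ∈ laurentSpan K :=
      fun c _ hv => Submodule.smul_mem _ c hv
    exact add_mem (add_mem (sub_mem (neg_mem (hs _ (derivation_mem hD ih)))
      (hs _ (X_zpow_mul_mem _ ih))) (hs _ ih)) (hs _ (X_zpow_mul_mem _ ih))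

lemma laurentCoeff_momentum_pow_apply (hD : D X = 1) (m j : ℕ) (s : ℤ) :
    laurentCoeff s ((momentum D h (gaugeFun α β τ) ^ j) (X ^ (-m : ℤ))) =
      gaugeCoeff h α β τ m j s := by
  induction j generalizing s with
  | zero => simp only [pow_zero, Module.End.one_apply, laurentCoeff_X_zpow, gaugeCoeff]
  | succ j ih =>
    rw [pow_succ', Module.End.mul_apply, momentum_gaugeFun_apply]
    simp only [map_add, map_sub, map_neg, map_smul, laurentCoeff_X_zpow_mul,
      laurentCoeff_derivation hD s (momentum_pow_apply_mem hD m j), ih, gaugeCoeff, smul_eq_mul,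
      sub_neg_eq_add]
    ring

/-- If the flow of `∑ k i j qⁱ pʲ` is polynomial in the chart `(q⁻¹, β q⁴ - q² p + τ q² - α q)`,
then the polar parts in that chart vanish. -/
theorem polar_coeff_eq_zero [CharZero K] (hh : h ≠ 0) (hD : D X = 1) (ε : K)
    {q p x y : Module.End K (RatFunc K)} (hq : q = LinearMap.mulLeft K (X : RatFunc K))
    (hp : p = momentum D h 0) (hx : x = LinearMap.mulLeft K (X : RatFunc K)⁻¹)
    (hy : y = β • q ^ 4 - q ^ 2 * p + τ • q ^ 2 - α • q) {N : ℕ} (k : Fin N → Fin N → K)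
    {H : Module.End K (RatFunc K)}
    (hH : H = ∑ i, ∑ j, k i j • (q ^ (i : ℕ) * p ^ (j : ℕ)))
    (hxH : x * H - H * x ∈ Algebra.adjoin K {x, y})
    (hyH : y * H - H * y + (ε * h) • q ^ 2 ∈ Algebra.adjoin K {x, y}) (m : ℕ) (s : ℤ)
    (hs : 0 < s) :
    ∑ i : Fin N, ∑ j : Fin N, k i j * gaugeCoeff h α β τ m j (s - i)
      + (if s = 1 - m then ε else 0) = 0 := by
  have hX : (X : RatFunc K) ≠ 0 := RatFunc.X_ne_zero
  set φ := gaugeFun α β τ with hφ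
  set P := momentum D h φ with hP
  set H' : Module.End K (RatFunc K) := ∑ i : Fin N, ∑ j : Fin N, k i j • (q ^ (i : ℕ) * P ^ (j : ℕ))
    with hH'
  set y' : Module.End K (RatFunc K) :=
    h • (LinearMap.mulLeft K ((X : RatFunc K) ^ 2) * (D : RatFunc K →ₗ[K] RatFunc K)) with hy'
  have hy'v : ∀ v, y' v = h • (X ^ 2 * D v) := fun v => by simp [y']
  have hqv : ∀ v, q v = X * v := fun v => by simp [hq]
  have hqn : ∀ (n : ℕ) v, (q ^ n) v = X ^ (n : ℤ) * v := fun n v => by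
    simp [hq, LinearMap.pow_mulLeft]
  have hxv : ∀ v, x v = X⁻¹ * v := fun v => by simp [hx]
  have rq : GaugeRel D h φ q q := hq ▸ GaugeRel.mulLeft X
  have rx : GaugeRel D h φ x x := hx ▸ GaugeRel.mulLeft X⁻¹
  have rp : GaugeRel D h φ p P := hp ▸ GaugeRel.momentum
  have rH : GaugeRel D h φ H H' := by
    rw [hH]
    exact .sum _ fun i _ => .sum _ fun j _ => ((rq.pow i).mul (rp.pow j)).smul_base _
  have ry : GaugeRel D h φ y y' := by
    have : y' = β • q ^ 4 - q ^ 2 * P + τ • q ^ 2 - α • q := by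
      ext v
      simp only [hy'v, LinearMap.sub_apply, LinearMap.add_apply, LinearMap.smul_apply,
        Module.End.mul_apply, hqn, hqv, hP, hφ, momentum_gaugeFun_apply]
      simp only [Algebra.smul_def, zpow_neg_one, zpow_ofNat, Nat.cast_ofNat]
      field_simp
      ring
    rw [this, hy]
    exact ((((rq.pow 4).smul_base _).sub ((rq.pow 2).mul rp)).add ((rq.pow 2).smul_base _)).sub
      (rq.smul_base _)
  have xL : ∀ v ∈ regularAtInfinity K, x v ∈ regularAtInfinity K := fun v hv => by
    rw [hxv]; exact inv_X_mul_mem_regularAtInfinity hv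
  have yL : ∀ v ∈ regularAtInfinity K, y' v ∈ regularAtInfinity K := fun v hv => by
    rw [hy'v]
    exact Submodule.smul_mem _ _
      ((X_sq_mul_derivation_mem_regularAtInfinity_iff hD (mem_regularAtInfinity.mp hv).1).mpr hv)
  have cx := GaugeRel.mapsTo_of_mem_adjoin hh hD rx ry ((rx.mul rH).sub (rH.mul rx)) _ xL yL hxH
  have cy := GaugeRel.mapsTo_of_mem_adjoin hh hD rx ry
    (((ry.mul rH).sub (rH.mul ry)).add ((rq.pow 2).smul_base (ε * h))) _ xL yL hyH
  have hmonom : ∀ n : ℕ, (X ^ (-n : ℤ) : RatFunc K) ∈ regularAtInfinity K := fun n =>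
    mem_regularAtInfinity.mpr ⟨X_zpow_mem _, fun r hr => by
      rw [laurentCoeff_X_zpow, if_neg (by lia)]⟩
  set W : Module.End K (RatFunc K) := H' + ε • q with hW
  have hWspan : ∀ n : ℕ, W (X ^ (-n : ℤ)) ∈ laurentSpan K := fun n => by
    rw [hW, LinearMap.add_apply, hH', LinearMap.smul_apply, hqv]
    simp only [LinearMap.sum_apply, LinearMap.smul_apply, Module.End.mul_apply, hqn]
    refine add_mem (sum_mem fun i _ => sum_mem fun j _ => Submodule.smul_mem _ _
      (X_zpow_mul_mem _ (momentum_pow_apply_mem hD n j))) (Submodule.smul_mem _ _ ?_)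
    simpa using X_zpow_mul_mem 1 (X_zpow_mem (K := K) (-n))
  have hWL : ∀ n : ℕ, W (X ^ (-n : ℤ)) ∈ regularAtInfinity K := fun n => by
    induction n with
    | zero =>
      rw [← X_sq_mul_derivation_mem_regularAtInfinity_iff hD (hWspan 0)]
      have h1 := cy 1 (by simpa using hmonom 0)
      simp only [LinearMap.add_apply, LinearMap.sub_apply, Module.End.mul_apply, hy'v,
        LinearMap.smul_apply, hqn, Derivation.map_one_eq_zero, mul_zero, smul_zero, map_zero,
        sub_zero] at h1
      have h2 := Submodule.smul_mem _ h⁻¹ h1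
      convert h2 using 1
      simp only [hW, LinearMap.add_apply, LinearMap.smul_apply, hqv, map_add, Derivation.map_smul,
        CharP.cast_eq_zero, neg_zero, zpow_zero, mul_one, hD, smul_add, smul_smul, mul_add,
        inv_mul_cancel₀ hh, one_smul]
      rw [show h⁻¹ * (ε * h) = ε by field_simp]
      simp
    | succ n ih =>
      have h1 := Submodule.sub_mem _ (xL _ ih) (cx _ (hmonom n))
      convert h1 using 1
      have e : (X : RatFunc K) ^ (-(n + 1 : ℕ) : ℤ) = x (X ^ (-n : ℤ)) := by
        rw [hxv, ← zpow_neg_one, ← zpow_add₀ hX]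
        congr 1
        push_cast
        ring
      rw [e]
      simp only [hW, LinearMap.add_apply, LinearMap.sub_apply, LinearMap.smul_apply,
        Module.End.mul_apply, hqv, hxv, mul_add, mul_smul_comm, mul_left_comm X]
      abel
  have hfin := (mem_regularAtInfinity.mp (hWL m)).2 s hs
  rw [hW, LinearMap.add_apply, hH', LinearMap.smul_apply, hqv] at hfin
  have e : (X : RatFunc K) * X ^ (-m : ℤ) = X ^ (1 - m : ℤ) := by
    rw [sub_eq_add_neg, zpow_add₀ hX, zpow_one]
  simpa only [LinearMap.sum_apply, LinearMap.smul_apply, Module.End.mul_apply, hqn, map_add,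
    map_sum, map_smul, smul_eq_mul, laurentCoeff_X_zpow_mul, hP, hφ,
    laurentCoeff_momentum_pow_apply hD, e, laurentCoeff_X_zpow, mul_ite, mul_one, mul_zero]
    using hfin

end Expansion

/-- The vanishing of the polar parts in both charts determines the coefficients of the quantum
Painlevé II Hamiltonian. -/
theorem coeff_eq_of_polar_coeff_eq_zero [CharZero K] {h a b t : K}
    (hh : h ≠ 0) (hab : a + b + 2 * h = 1)
    (k : Fin 5 → Fin 5 → K)
    (h₀ : ∀ (m : ℕ) (s : ℤ), 0 < s →
      ∑ i : Fin 5, ∑ j : Fin 5, k i j * gaugeCoeff h b 0 0 m j (s - i) = 0)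
    (h₁ : ∀ (m : ℕ) (s : ℤ), 0 < s →
      ∑ i : Fin 5, ∑ j : Fin 5, k i j * gaugeCoeff h a 2 t m j (s - i)
        + (if s = 1 - m then 1 else 0) = 0) :
    k 0 1 = -(t / 2) ∧ k 0 2 = 1 / 2 ∧ k 1 0 = -b ∧ k 2 1 = -1 ∧
      ∀ i j, (i, j) ∉ ({(0, 0), (0, 1), (0, 2), (1, 0), (2, 1)} : Set (Fin 5 × Fin 5)) →
        k i j = 0 := by
  simp only [Fin.sum_univ_five, Fin.isValue, Fin.coe_ofNat_eq_mod] at h₀ h₁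
  have k40 : k 4 0 = 0 := by simpa [gaugeCoeff] using h₀ 0 4 (by norm_num)
  have k44 : k 4 4 = 0 := by simpa [gaugeCoeff] using h₁ 0 12 (by norm_num)
  have k34 : k 3 4 = 0 := by simpa [gaugeCoeff] using h₁ 0 11 (by norm_num)
  have u₁ := h₀ 0 3 (by norm_num)
  have u₂ := h₀ 1 2 (by norm_num)
  norm_num [gaugeCoeff] at u₁ u₂
  have k41 : k 4 1 = 0 := mul_left_cancel₀ hh (by linear_combination u₂ - u₁)
  have k30 : k 3 0 = 0 := by simpa [k41] using u₁
  simp only [k40, k44, k34, k41, k30, zero_mul, zero_add, add_zero] at h₀ h₁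
  have v₁ := h₁ 0 10 (by norm_num)
  have v₂ := h₁ 0 7 (by norm_num)
  have v₃ := h₁ 1 6 (by norm_num)
  norm_num [gaugeCoeff] at v₁ v₂ v₃
  have k24 : k 2 4 = 0 := by grind
  have k43 : k 4 3 = 0 := by grind
  simp only [k24, k43, zero_mul, add_zero] at h₀ h₁
  have w₁ := h₁ 0 9 (by norm_num)
  have w₂ := h₁ 0 6 (by norm_num)
  have w₃ := h₁ 1 5 (by norm_num)
  norm_num [gaugeCoeff] at w₁ w₂ w₃
  have k14 : k 1 4 = 0 := by grind
  have k33 : k 3 3 = 0 := by grind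
  simp only [k14, k33, zero_mul, add_zero] at h₀ h₁
  have x₁ := h₁ 0 7 (by norm_num)
  have x₂ := h₁ 0 4 (by norm_num)
  have x₃ := h₁ 1 3 (by norm_num)
  norm_num [gaugeCoeff] at x₁ x₂ x₃
  have k13 : k 1 3 = 0 := by grind
  have k32 : k 3 2 = 0 := by grind
  simp only [k13, k32, zero_mul, add_zero] at h₀ h₁
  clear u₁ u₂ v₁ v₂ v₃ w₁ w₂ w₃ x₁ x₂ x₃
  have a2 := h₀ 0 2 (by norm_num)
  have b1 := h₀ 1 1 (by norm_num)
  have a1 := h₀ 0 1 (by norm_num)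
  have c8 := h₁ 0 8 (by norm_num)
  have c6 := h₁ 0 6 (by norm_num)
  have c5 := h₁ 0 5 (by norm_num)
  have d4 := h₁ 1 4 (by norm_num)
  have c4 := h₁ 0 4 (by norm_num)
  have c3 := h₁ 0 3 (by norm_num)
  have d2 := h₁ 1 2 (by norm_num)
  have c2 := h₁ 0 2 (by norm_num)
  have d1 := h₁ 1 1 (by norm_num)
  have c1 := h₁ 0 1 (by norm_num)
  clear h₀ h₁
  norm_num [gaugeCoeff] at a2 b1 a1 c8 c6 c5 d4 c4 c3 d2 c2 d1 c1
  have k42 : k 4 2 = 4 * k 0 4 := by grind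
  have k23 : k 2 3 = -4 * k 0 4 := by grind
  simp only [k42, k23] at a2 b1 c6 c5 d4 c4 c3 d2 c2 d1 c1
  have k31 : k 3 1 = -2 * (h - b) * (4 * k 0 4) :=
    mul_left_cancel₀ hh (by linear_combination b1 - a2)
  have k12 : k 1 2 = 4 * (1 - b) * k 0 4 := by grind
  have k04 : k 0 4 = 0 := by grind
  simp only [k04, mul_zero, zero_mul, add_zero]
    at a2 b1 k42 k23 k31 k12 c6 c4 c3 d2 c2 d1 c1
  have k03 : k 0 3 = 0 := by grind
  have k22 : k 2 2 = 0 := by grind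
  have k20 : k 2 0 = 0 := by grind
  have k11 : k 1 1 = 0 := by grind
  have k21 : k 2 1 = -2 * k 0 2 := by grind
  have k02 : k 0 2 = 1 / 2 := by grind
  refine ⟨by grind, k02, by grind, by grind, fun i j hij => ?_⟩
  fin_cases i <;> fin_cases j <;> first | assumption | simp at hij

/-- A normally ordered sum whose coefficients are those of the quantum Painlevé II Hamiltonian. -/
lemma sum_smul_eq_of_coeff_eq {A : Type*} [Ring A] [Algebra K A] {b t : K}
    (k : Fin 5 → Fin 5 → K) (q p : A) (k00 : k 0 0 = 0)
    (k01 : k 0 1 = -(t / 2)) (k02 : k 0 2 = 1 / 2) (k10 : k 1 0 = -b) (k21 : k 2 1 = -1)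
    (k_eq_zero : ∀ i j,
      (i, j) ∉ ({(0, 0), (0, 1), (0, 2), (1, 0), (2, 1)} : Set (Fin 5 × Fin 5)) → k i j = 0) :
    ∑ i : Fin 5, ∑ j : Fin 5, k i j • (q ^ (i : ℕ) * p ^ (j : ℕ)) =
      ((1 : K) / 2) • p ^ 2 - q ^ 2 * p - (t / 2) • p - b • q := by
  have sum_eq : ∀ f : Fin 5 → Fin 5 → A, ∑ i, ∑ j, k i j • f i j =
      k 0 1 • f 0 1 + k 0 2 • f 0 2 + k 1 0 • f 1 0 + k 2 1 • f 2 1 := by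
    intro f
    simp [Fin.sum_univ_five, k00, k_eq_zero]
  rw [sum_eq, k01, k02, k10, k21]
  simp [neg_smul]
  abel

end QuantumPII

/-- Uniqueness of the quantum Painlevé II Hamiltonian (Takano characterization).
Let `F = ℂ(t) = RatFunc ℂ`, `V = F(z) = RatFunc F`, `R = End_F(V)`, `q`
multiplication by `z` (with two-sided inverse `qi`), and `p = -h·(d/dz)`, where
`d/dz` is the (unique) `F`-derivation `D` of `F(z)` with `D z = 1`.  If
`H = ∑_{0 ≤ i,j ≤ 4, (i,j) ≠ (0,0)} k_{ij} qⁱpʲ` with `k_{ij} ∈ F` satisfies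
`[x₀,H], [y₀,H] ∈ A₀` and `[x₁,H], [y₁,H] + h·q² ∈ A₁`, where `A₀, A₁` are the
`F`-subalgebras generated by the Takano chart coordinates
`(x₀,y₀) = (q⁻¹, -bq - q²p)` and `(x₁,y₁) = (q⁻¹, 2q⁴ - q²p + tq² - aq)`,
then `H = (1/2)p² - q²p - (t/2)p - bq` is the quantum Painlevé II
Hamiltonian. -/
theorem quantum_PII_hamiltonian_unique
    (h a b : ℂ) (hh : h ≠ 0) (hab : a + b + 2 * h = 1)
    (t : RatFunc ℂ) (ht : t = RatFunc.X)
    (q p qi : Module.End (RatFunc ℂ) (RatFunc (RatFunc ℂ)))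
    (D : Derivation (RatFunc ℂ) (RatFunc (RatFunc ℂ)) (RatFunc (RatFunc ℂ)))
    (hq : q = LinearMap.mulLeft (RatFunc ℂ) (RatFunc.X : RatFunc (RatFunc ℂ)))
    (hD : D RatFunc.X = 1)
    (hp : p = -(algebraMap ℂ (RatFunc ℂ) h •
        (D : RatFunc (RatFunc ℂ) →ₗ[RatFunc ℂ] RatFunc (RatFunc ℂ))))
    (hqi : q * qi = 1) (hiq : qi * q = 1)
    (x₀ y₀ x₁ y₁ : Module.End (RatFunc ℂ) (RatFunc (RatFunc ℂ)))
    (hx₀ : x₀ = qi)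
    (hy₀ : y₀ = -(algebraMap ℂ (RatFunc ℂ) b • q) - q ^ 2 * p)
    (hx₁ : x₁ = qi)
    (hy₁ : y₁ = (2 : RatFunc ℂ) • q ^ 4 - q ^ 2 * p + t • q ^ 2
        - algebraMap ℂ (RatFunc ℂ) a • q)
    (k : Fin 5 → Fin 5 → RatFunc ℂ) (hk : k 0 0 = 0)
    (H : Module.End (RatFunc ℂ) (RatFunc (RatFunc ℂ)))
    (hH : H = ∑ i : Fin 5, ∑ j : Fin 5, k i j • (q ^ (i : ℕ) * p ^ (j : ℕ)))
    (hol₀x : x₀ * H - H * x₀ ∈ Algebra.adjoin (RatFunc ℂ)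
        ({x₀, y₀} : Set (Module.End (RatFunc ℂ) (RatFunc (RatFunc ℂ)))))
    (hol₀y : y₀ * H - H * y₀ ∈ Algebra.adjoin (RatFunc ℂ)
        ({x₀, y₀} : Set (Module.End (RatFunc ℂ) (RatFunc (RatFunc ℂ)))))
    (hol₁x : x₁ * H - H * x₁ ∈ Algebra.adjoin (RatFunc ℂ)
        ({x₁, y₁} : Set (Module.End (RatFunc ℂ) (RatFunc (RatFunc ℂ)))))
    (hol₁y : (y₁ * H - H * y₁) + algebraMap ℂ (RatFunc ℂ) h • q ^ 2
        ∈ Algebra.adjoin (RatFunc ℂ)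
        ({x₁, y₁} : Set (Module.End (RatFunc ℂ) (RatFunc (RatFunc ℂ))))) :
    H = ((1 : RatFunc ℂ) / 2) • p ^ 2 - q ^ 2 * p - (t / 2) • p
        - algebraMap ℂ (RatFunc ℂ) b • q := by
  have hp' : p = QuantumPII.momentum D (algebraMap ℂ (RatFunc ℂ) h) 0 := by
    rw [hp]; ext v; simp [QuantumPII.momentum]
  have hX : (RatFunc.X : RatFunc (RatFunc ℂ)) ≠ 0 := RatFunc.X_ne_zero
  have hqi' : qi = LinearMap.mulLeft (RatFunc ℂ) (RatFunc.X : RatFunc (RatFunc ℂ))⁻¹ := by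
    refine left_inv_eq_right_inv hiq ?_
    rw [hq]
    ext v
    exact mul_inv_cancel_left₀ hX v
  have hh' : algebraMap ℂ (RatFunc ℂ) h ≠ 0 := by simpa using hh
  have hab' : algebraMap ℂ (RatFunc ℂ) a + algebraMap ℂ (RatFunc ℂ) b
      + 2 * algebraMap ℂ (RatFunc ℂ) h = 1 := by
    simpa only [map_add, map_mul, map_ofNat, map_one] using congrArg (algebraMap ℂ (RatFunc ℂ)) hab
  have pole₀ := QuantumPII.polar_coeff_eq_zero (β := 0) (τ := 0)
    (α := algebraMap ℂ (RatFunc ℂ) b) hh' hD 0 hq hp' (hx₀.trans hqi')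
    (by rw [hy₀, zero_smul, zero_smul]; abel) k hH hol₀x
    (by simpa only [zero_mul, zero_smul, add_zero] using hol₀y)
  have pole₁ := QuantumPII.polar_coeff_eq_zero hh' hD 1 hq hp' (hx₁.trans hqi') hy₁ k hH hol₁x
    (by simpa only [one_mul] using hol₁y)
  obtain ⟨k01, k02, k10, k21, k_eq_zero⟩ := QuantumPII.coeff_eq_of_polar_coeff_eq_zero hh' hab' k
    (fun m s hs => by simpa only [ite_self, add_zero] using pole₀ m s hs) pole₁
  rw [hH]
  exact QuantumPII.sum_smul_eq_of_coeff_eq k q p hk k01 k02 k10 k21 k_eq_zero
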